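/- arXiv:0707.1468 — 7 statements merged into one kernel-verified Lean document; each statement's English description precedes it below -/
import Mathlib

section
/- Let r₁, r₂, r₃, r₄ > 0 and let θ₁ > θ₂ > θ₃ > θ₄ > θ₁ − 2π be real numbers, and set u_i = r_i·(cos θ_i, sin θ_i, 1) for i = 1, 2, 3, 4 (isotropic vectors with positive z-coordinate whose rays meet the circle at infinity in this cyclic order). With λ_{ij} = λ(u_i, u_j), Ptolemy's equation holds: λ₁₃·λ₂₄ = λ₁₂·λ₃₄ + λ₁₄·λ₂₃. -/
/-- The Minkowski bilinear form `B((x,y,z),(x',y',z')) = xx' + yy' − zz'` on `ℝ³`. -/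
def minkB (u w : Fin 3 → ℝ) : ℝ := u 0 * w 0 + u 1 * w 1 - u 2 * w 2

/-- The lambda length of two isotropic vectors `u, u'` with `B(u,u') ≤ 0`:
`λ(u,u') = √(−B(u,u'))`. -/
noncomputable def lambdaLength (u w : Fin 3 → ℝ) : ℝ := Real.sqrt (-(minkB u w))

theorem lambdaLength_aux (r s a b : ℝ) (hr : 0 < r) (hs : 0 < s) (h1 : b < a)
    (h2 : a - b < 2 * Real.pi) :
    lambdaLength (r • ![Real.cos a, Real.sin a, 1]) (s • ![Real.cos b, Real.sin b, 1])
      = √2 * √r * √s * (Real.sin (a / 2) * Real.cos (b / 2)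
          - Real.cos (a / 2) * Real.sin (b / 2)) := by
  have hs0 : 0 ≤ Real.sin (a / 2 - b / 2) :=
    Real.sin_nonneg_of_nonneg_of_le_pi (by linarith) (by linarith)
  have hc : Real.cos (a - b) = 1 - 2 * Real.sin (a / 2 - b / 2) ^ 2 := by
    have h : a - b = 2 * (a / 2 - b / 2) := by ring
    rw [h, Real.cos_two_mul, Real.cos_sq']
    ring
  rw [← Real.sin_sub]
  unfold lambdaLength
  have hB : -(minkB (r • ![Real.cos a, Real.sin a, 1]) (s • ![Real.cos b, Real.sin b, 1]))
      = (√2 * √r * √s * Real.sin (a / 2 - b / 2)) ^ 2 := by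
    rw [mul_pow, mul_pow, mul_pow, Real.sq_sqrt hr.le, Real.sq_sqrt hs.le,
      Real.sq_sqrt (by norm_num)]
    rw [Real.cos_sub] at hc
    simp [minkB]
    linear_combination (-(r * s)) * hc
  rw [hB, Real.sqrt_sq (by positivity)]

/-- Lemma 3.1 a) [Ptolemy's equation]: for four isotropic vectors with positive
`z`-coordinate whose rays meet the circle at infinity in clockwise cyclic order,
`λ₁₃·λ₂₄ = λ₁₂·λ₃₄ + λ₁₄·λ₂₃`. -/
theorem ptolemy_equation (r : Fin 4 → ℝ) (hr : ∀ i, 0 < r i) (θ : Fin 4 → ℝ)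
    (h12 : θ 1 < θ 0) (h23 : θ 2 < θ 1) (h34 : θ 3 < θ 2)
    (h41 : θ 0 - 2 * Real.pi < θ 3)
    (u : Fin 4 → Fin 3 → ℝ)
    (hu : ∀ i, u i = r i • ![Real.cos (θ i), Real.sin (θ i), 1]) :
    lambdaLength (u 0) (u 2) * lambdaLength (u 1) (u 3)
      = lambdaLength (u 0) (u 1) * lambdaLength (u 2) (u 3)
        + lambdaLength (u 0) (u 3) * lambdaLength (u 1) (u 2) := by
  simp only [hu]
  rw [lambdaLength_aux _ _ _ _ (hr 0) (hr 2) (by linarith) (by linarith),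
    lambdaLength_aux _ _ _ _ (hr 1) (hr 3) (by linarith) (by linarith),
    lambdaLength_aux _ _ _ _ (hr 0) (hr 1) (by linarith) (by linarith),
    lambdaLength_aux _ _ _ _ (hr 2) (hr 3) (by linarith) (by linarith),
    lambdaLength_aux _ _ _ _ (hr 0) (hr 3) (by linarith) (by linarith),
    lambdaLength_aux _ _ _ _ (hr 1) (hr 2) (by linarith) (by linarith)]
  ring
end

section
/- Let u₁, u₂, u₃ ∈ ℝ³ be pairwise linearly independent isotropic vectors each with positive z-coordinate, and let λ_{ij} = λ(u_i, u_j) for i ≠ j (one has B(u_i, u_j) < 0 for i ≠ j, so these are positive). Then the set {w ∈ ℝ³ : w lies in the affine plane spanned by u₁, u₂, u₃ and Q(w) = 0} is bounded (i.e., the conic section cut on the light cone by this affine plane is an ellipse) if and only if λ₁₂, λ₁₃, λ₂₃ satisfy the three strict triangle inequalities: λ₁₂ < λ₁₃ + λ₂₃, λ₁₃ < λ₁₂ + λ₂₃, and λ₂₃ < λ₁₂ + λ₁₃. -/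
lemma minkB_neg_aux (u v : Fin 3 → ℝ) (hu : minkB u u = 0) (hv : minkB v v = 0)
    (hzu : 0 < u 2) (hzv : 0 < v 2) (h : LinearIndependent ℝ ![u, v]) :
    0 < -(minkB u v) := by
  by_contra hc
  unfold minkB at *
  have hk : (v 2 * u 0 - u 2 * v 0) ^ 2 + (v 2 * u 1 - u 2 * v 1) ^ 2 ≤ 0 := by
    have h1 : 0 ≤ (u 2 * v 2) * (u 0 * v 0 + u 1 * v 1 - u 2 * v 2) :=
      mul_nonneg (by positivity) (by linarith)
    have h2 : (v 2 * u 0 - u 2 * v 0) ^ 2 + (v 2 * u 1 - u 2 * v 1) ^ 2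
        = -2 * ((u 2 * v 2) * (u 0 * v 0 + u 1 * v 1 - u 2 * v 2)) := by
      linear_combination (v 2) ^ 2 * hu + (u 2) ^ 2 * hv
    linarith
  have e0 : v 2 * u 0 - u 2 * v 0 = 0 := by
    have : (v 2 * u 0 - u 2 * v 0) ^ 2 = 0 := by
      nlinarith [sq_nonneg (v 2 * u 0 - u 2 * v 0), sq_nonneg (v 2 * u 1 - u 2 * v 1)]
    exact pow_eq_zero_iff (two_ne_zero) |>.1 this
  have e1 : v 2 * u 1 - u 2 * v 1 = 0 := by
    have : (v 2 * u 1 - u 2 * v 1) ^ 2 = 0 := by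
      nlinarith [sq_nonneg (v 2 * u 0 - u 2 * v 0), sq_nonneg (v 2 * u 1 - u 2 * v 1)]
    exact pow_eq_zero_iff (two_ne_zero) |>.1 this
  have h3 := LinearIndependent.pair_iff.1 h (v 2) (-(u 2)) (by
    ext i
    fin_cases i <;> simp <;> linarith)
  linarith [h3.1]

lemma mem_span_aux (u₁ u₂ u₃ w : Fin 3 → ℝ) :
    w ∈ affineSpan ℝ ({u₁, u₂, u₃} : Set (Fin 3 → ℝ)) ↔
      ∃ α β : ℝ, w = α • (u₁ - u₃) + β • (u₂ - u₃) + u₃ := by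
  have m3 : u₃ ∈ ({u₁, u₂, u₃} : Set (Fin 3 → ℝ)) := by simp
  have key : vectorSpan ℝ ({u₁, u₂, u₃} : Set (Fin 3 → ℝ))
      = Submodule.span ℝ {u₁ - u₃, u₂ - u₃} := by
    rw [vectorSpan_eq_span_vsub_set_right ℝ m3]
    simp only [Set.image_insert_eq, Set.image_singleton, vsub_eq_sub, sub_self]
    rw [Set.insert_comm, Set.pair_comm, Set.insert_comm, Submodule.span_insert_zero,
      Set.pair_comm]
    try rw [Set.pair_comm]
  constructor
  · intro h
    have h1 := vsub_mem_vectorSpan_of_mem_affineSpan_of_mem_affineSpan h (mem_affineSpan ℝ m3)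
    rw [key, Submodule.mem_span_pair] at h1
    obtain ⟨α, β, h⟩ := h1
    refine ⟨α, β, ?_⟩
    rw [h]; simp
  · rintro ⟨α, β, rfl⟩
    apply vadd_mem_affineSpan_of_mem_affineSpan_of_mem_vectorSpan (mem_affineSpan ℝ m3)
    rw [key, Submodule.mem_span_pair]
    exact ⟨α, β, rfl⟩

lemma minkB_comb_aux (u₁ u₂ u₃ : Fin 3 → ℝ)
    (hiso₁ : minkB u₁ u₁ = 0) (hiso₂ : minkB u₂ u₂ = 0) (hiso₃ : minkB u₃ u₃ = 0) (α β : ℝ) :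
    minkB (α • (u₁ - u₃) + β • (u₂ - u₃) + u₃) (α • (u₁ - u₃) + β • (u₂ - u₃) + u₃) =
      2 * (α * β * minkB u₁ u₂ + α * (1 - α - β) * minkB u₁ u₃
        + β * (1 - α - β) * minkB u₂ u₃) := by
  simp only [minkB, Pi.add_apply, Pi.smul_apply, Pi.sub_apply, smul_eq_mul] at *
  linear_combination α ^ 2 * hiso₁ + β ^ 2 * hiso₂ + (1 - α - β) ^ 2 * hiso₃

lemma alpha_aux (u₁ u₂ u₃ : Fin 3 → ℝ)
    (hiso₁ : minkB u₁ u₁ = 0) (hiso₂ : minkB u₂ u₂ = 0) (hiso₃ : minkB u₃ u₃ = 0) (α β : ℝ) :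
    minkB u₁ u₃ * minkB (α • (u₁ - u₃) + β • (u₂ - u₃) + u₃) u₂
      + minkB u₁ u₂ * minkB (α • (u₁ - u₃) + β • (u₂ - u₃) + u₃) u₃
      - minkB u₂ u₃ * minkB (α • (u₁ - u₃) + β • (u₂ - u₃) + u₃) u₁
      = 2 * minkB u₁ u₃ * minkB u₁ u₂ * α := by
  have l1 : minkB (α • (u₁ - u₃) + β • (u₂ - u₃) + u₃) u₁
      = β * minkB u₁ u₂ + (1 - α - β) * minkB u₁ u₃ := by
    simp only [minkB, Pi.add_apply, Pi.smul_apply, Pi.sub_apply, smul_eq_mul] at *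
    linear_combination α * hiso₁
  have l2 : minkB (α • (u₁ - u₃) + β • (u₂ - u₃) + u₃) u₂
      = α * minkB u₁ u₂ + (1 - α - β) * minkB u₂ u₃ := by
    simp only [minkB, Pi.add_apply, Pi.smul_apply, Pi.sub_apply, smul_eq_mul] at *
    linear_combination β * hiso₂
  have l3 : minkB (α • (u₁ - u₃) + β • (u₂ - u₃) + u₃) u₃
      = α * minkB u₁ u₃ + β * minkB u₂ u₃ := by
    simp only [minkB, Pi.add_apply, Pi.smul_apply, Pi.sub_apply, smul_eq_mul] at *
    linear_combination (1 - α - β) * hiso₃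
  rw [l1, l2, l3]; ring

lemma triangle_aux (r t s : ℝ) (hr : 0 < r) (ht : 0 < t) (hs : 0 < s) :
    0 < 4 * s ^ 2 * t ^ 2 - (s ^ 2 + t ^ 2 - r ^ 2) ^ 2 ↔
      (r < t + s ∧ t < r + s ∧ s < r + t) := by
  have e : 4 * s ^ 2 * t ^ 2 - (s ^ 2 + t ^ 2 - r ^ 2) ^ 2
      = (r + t + s) * ((t + s - r) * (r + s - t) * (r + t - s)) := by ring
  rw [e, mul_pos_iff_of_pos_left (by positivity)]
  constructor
  · intro h
    by_contra hc
    rcases lt_or_ge r (t + s) with h1 | h1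
    · rcases lt_or_ge t (r + s) with h2 | h2
      · rcases lt_or_ge s (r + t) with h3 | h3
        · exact hc ⟨h1, h2, h3⟩
        · have := mul_pos (sub_pos.2 h1) (sub_pos.2 h2)
          nlinarith
      · have := mul_pos (sub_pos.2 h1) (show 0 < r + t - s by linarith)
        nlinarith
    · have := mul_pos (show 0 < r + s - t by linarith) (show 0 < r + t - s by linarith)
      nlinarith
  · rintro ⟨h1, h2, h3⟩
    exact mul_pos (mul_pos (by linarith) (by linarith)) (by linarith)

/-- If the discriminant is positive, the solutions are bounded. -/
lemma bound_aux (a b c : ℝ) (ha : 0 < a) (hb : 0 < b)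
    (hD : 0 < 4 * a * b - (a + b - c) ^ 2) :
    ∃ M : ℝ, ∀ α β : ℝ, b * α ^ 2 + a * β ^ 2 + (a + b - c) * (α * β) = b * α + a * β →
      |α| ≤ M ∧ |β| ≤ M := by
  set D := 4 * a * b - (a + b - c) ^ 2 with hDdef
  set k := 4 * (a + b) / D with hk
  refine ⟨k * (a + b), fun α β h => ?_⟩
  have h1 : D * (α ^ 2 + β ^ 2) ≤ 4 * (a + b) * (b * α + a * β) := by
    rw [← h, hDdef]
    nlinarith [sq_nonneg (2 * a * β + (a + b - c) * α), sq_nonneg (2 * b * α + (a + b - c) * β)]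
  have hk0 : 0 < k := by positivity
  have h2 : α ^ 2 + β ^ 2 ≤ k * (b * α + a * β) := by
    rw [hk, div_mul_eq_mul_div, le_div_iff₀ hD]; linarith
  have h3 : α ^ 2 + β ^ 2 ≤ (k * (a + b)) * max |α| |β| := by
    refine h2.trans ?_
    rw [mul_assoc]
    refine mul_le_mul_of_nonneg_left ?_ hk0.le
    have p1 : b * α ≤ b * max |α| |β| :=
      mul_le_mul_of_nonneg_left ((le_abs_self _).trans (le_max_left _ _)) hb.le
    have p2 : a * β ≤ a * max |α| |β| :=
      mul_le_mul_of_nonneg_left ((le_abs_self _).trans (le_max_right _ _)) ha.le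
    linarith
  have h4 : (max |α| |β|) ^ 2 ≤ α ^ 2 + β ^ 2 := by
    rcases max_choice |α| |β| with h | h <;> rw [h, sq_abs] <;> nlinarith [sq_nonneg α, sq_nonneg β]
  have h5 : max |α| |β| ≤ k * (a + b) := by
    by_contra hc
    push Not at hc
    have : 0 < max |α| |β| := lt_trans (by positivity) hc
    nlinarith
  exact ⟨(le_max_left _ _).trans h5, (le_max_right _ _).trans h5⟩

/-- If the discriminant is nonpositive, the first coordinates of solutions are unbounded. -/
lemma unbound_aux (a b c : ℝ) (ha : 0 < a) (hb : 0 < b) (hc : 0 < c)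
    (hD : 4 * a * b - (a + b - c) ^ 2 ≤ 0) (K : ℝ)
    (hK : ∀ α β : ℝ, b * α ^ 2 + a * β ^ 2 + (a + b - c) * (α * β) = b * α + a * β →
      |α| ≤ K) : False := by
  set E := Real.sqrt ((a + b - c) ^ 2 - 4 * a * b) with hE
  have hE0 : 0 ≤ E := Real.sqrt_nonneg _
  have hE2 : E ^ 2 = (a + b - c) ^ 2 - 4 * a * b := Real.sq_sqrt (by linarith)
  obtain ⟨q, hq⟩ : ∃ q, 2 * a * q = E - (a + b - c) :=
    ⟨(E - (a + b - c)) / (2 * a), by field_simp⟩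
  have hroot : a * q ^ 2 + (a + b - c) * q + b = 0 := by
    have : 4 * a * (a * q ^ 2 + (a + b - c) * q + b) = 0 := by
      linear_combination (2 * a * q + E + (a + b - c)) * hq + hE2
    rcases mul_eq_zero.1 this with h | h
    · linarith
    · exact h
  have hne : b + a * q ≠ 0 := by
    intro h
    have hbc : b * c = 0 := by
      linear_combination a * hroot - (a * q + a - c) * h
    have := mul_pos hb hc
    linarith
  have hall : ∀ ε : ℝ, 0 < ε → |b + a * (q + ε)| ≤ K * (ε * (a * ε + E)) := by
    intro ε hε
    have hF : 0 < ε * (a * ε + E) := by positivity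
    have hF' : a * (q + ε) ^ 2 + (a + b - c) * (q + ε) + b = ε * (a * ε + E) := by
      linear_combination hroot + ε * hq
    have := hK ((b + a * (q + ε)) / (ε * (a * ε + E)))
      ((b + a * (q + ε)) / (ε * (a * ε + E)) * (q + ε)) (by
        have ht : (b + a * (q + ε)) / (ε * (a * ε + E)) * (ε * (a * ε + E)) = b + a * (q + ε) :=
          div_mul_cancel₀ _ hF.ne'
        set t := (b + a * (q + ε)) / (ε * (a * ε + E))
        linear_combination t ^ 2 * hF' + t * ht)
    rwa [abs_div, abs_of_pos hF, div_le_iff₀ hF] at this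
  have hlim : |b + a * (q + 0)| ≤ K * (0 * (a * 0 + E)) := by
    have c1 : Filter.Tendsto (fun ε : ℝ => |b + a * (q + ε)|) (nhdsWithin 0 (Set.Ioi 0))
        (nhds |b + a * (q + 0)|) :=
      (Continuous.tendsto (by fun_prop) 0).mono_left nhdsWithin_le_nhds
    have c2 : Filter.Tendsto (fun ε : ℝ => K * (ε * (a * ε + E))) (nhdsWithin 0 (Set.Ioi 0))
        (nhds (K * (0 * (a * 0 + E)))) :=
      (Continuous.tendsto (by fun_prop) 0).mono_left nhdsWithin_le_nhds
    refine le_of_tendsto_of_tendsto c1 c2 ?_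
    filter_upwards [self_mem_nhdsWithin] with ε hε using hall ε hε
  have : |b + a * q| ≤ 0 := by simpa using hlim
  exact hne (abs_nonpos_iff.1 this)

/-- Lemma 3.1 f) [Ellipticity]: for pairwise linearly independent isotropic vectors
`u₁, u₂, u₃` with positive `z`-coordinate, the conic section cut on the light cone by the
affine plane spanned by `u₁, u₂, u₃` is an ellipse (i.e., the intersection is bounded) if
and only if the lambda lengths `λ₁₂, λ₁₃, λ₂₃` satisfy the three strict triangle
inequalities. -/
theorem elliptic_iff_strict_triangle_inequalities
    (u₁ u₂ u₃ : Fin 3 → ℝ)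
    (hiso₁ : minkB u₁ u₁ = 0) (hiso₂ : minkB u₂ u₂ = 0) (hiso₃ : minkB u₃ u₃ = 0)
    (hz₁ : 0 < u₁ 2) (hz₂ : 0 < u₂ 2) (hz₃ : 0 < u₃ 2)
    (hind₁₂ : LinearIndependent ℝ ![u₁, u₂])
    (hind₁₃ : LinearIndependent ℝ ![u₁, u₃])
    (hind₂₃ : LinearIndependent ℝ ![u₂, u₃]) :
    Bornology.IsBounded
        {w : Fin 3 → ℝ |
          w ∈ affineSpan ℝ ({u₁, u₂, u₃} : Set (Fin 3 → ℝ)) ∧ minkB w w = 0} ↔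
      (lambdaLength u₁ u₂ < lambdaLength u₁ u₃ + lambdaLength u₂ u₃ ∧
        lambdaLength u₁ u₃ < lambdaLength u₁ u₂ + lambdaLength u₂ u₃ ∧
        lambdaLength u₂ u₃ < lambdaLength u₁ u₂ + lambdaLength u₁ u₃) := by
  have hc := minkB_neg_aux u₁ u₂ hiso₁ hiso₂ hz₁ hz₂ hind₁₂
  have hb := minkB_neg_aux u₁ u₃ hiso₁ hiso₃ hz₁ hz₃ hind₁₃
  have ha := minkB_neg_aux u₂ u₃ hiso₂ hiso₃ hz₂ hz₃ hind₂₃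
  have hcomb := minkB_comb_aux u₁ u₂ u₃ hiso₁ hiso₂ hiso₃
  have halpha := alpha_aux u₁ u₂ u₃ hiso₁ hiso₂ hiso₃
  unfold lambdaLength
  rw [← triangle_aux _ _ _ (Real.sqrt_pos.2 hc) (Real.sqrt_pos.2 hb) (Real.sqrt_pos.2 ha),
    Real.sq_sqrt hc.le, Real.sq_sqrt hb.le, Real.sq_sqrt ha.le]
  constructor
  · intro hbd
    by_contra hD
    push Not at hD
    obtain ⟨K, hK⟩ := hbd.isCompact_closure.exists_bound_of_continuousOn
      (f := fun w : Fin 3 → ℝ => (minkB u₁ u₃ * minkB w u₂ + minkB u₁ u₂ * minkB w u₃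
        - minkB u₂ u₃ * minkB w u₁) / (2 * minkB u₁ u₃ * minkB u₁ u₂))
      (by unfold minkB; exact Continuous.continuousOn (by fun_prop))
    refine unbound_aux _ _ _ ha hb hc hD K fun α β h => ?_
    have := hK (α • (u₁ - u₃) + β • (u₂ - u₃) + u₃) (subset_closure
      ⟨(mem_span_aux _ _ _ _).2 ⟨α, β, rfl⟩, by rw [hcomb]; linear_combination 2 * h⟩)
    rw [halpha, Real.norm_eq_abs] at this
    have hb' : minkB u₁ u₃ ≠ 0 := (neg_pos.1 hb).ne
    have hc' : minkB u₁ u₂ ≠ 0 := (neg_pos.1 hc).ne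
    rwa [mul_div_cancel_left₀ _ (by positivity)] at this
  · intro hD
    obtain ⟨M, hM⟩ := bound_aux _ _ _ ha hb hD
    have hcpt : IsCompact ((fun p : ℝ × ℝ => p.1 • (u₁ - u₃) + p.2 • (u₂ - u₃) + u₃) ''
        (Set.Icc (-M) M ×ˢ Set.Icc (-M) M)) :=
      (isCompact_Icc.prod isCompact_Icc).image (by fun_prop)
    refine hcpt.isBounded.subset ?_
    rintro w ⟨hw, hq⟩
    obtain ⟨α, β, rfl⟩ := (mem_span_aux _ _ _ _).1 hw
    rw [hcomb] at hq
    obtain ⟨h1, h2⟩ := hM α β (by linear_combination (1 / 2) * hq)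
    exact ⟨(α, β), ⟨abs_le.1 h1, abs_le.1 h2⟩, rfl⟩
end

section
/- Let a, b, c, d, e be positive real numbers with e ≥ c + d. If (a² + b² − e²)/(a·b·e) + (c² + d² − e²)/(c·d·e) ≥ 0, then (a − b)² ≥ e²; in particular max(a, b) ≥ min(a, b) + e, so the triangle inequality fails weakly for the triple a, b, e. -/
/-- The basic algebraic fact about simplicial coordinates used in Lemma 3.5: if
`e ≥ c + d` and the simplicial coordinate
`(a² + b² − e²)/(abe) + (c² + d² − e²)/(cde)` is nonnegative, then `(a − b)² ≥ e²`;
in particular `max a b ≥ min a b + e`, so the triangle inequality fails weakly for the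
triple `a, b, e`. -/
theorem simplicial_coordinate_propagates_triangle_failure
    (a b c d e : ℝ) (ha : 0 < a) (hb : 0 < b) (hc : 0 < c) (hd : 0 < d) (he : 0 < e)
    (hcd : c + d ≤ e)
    (hX : 0 ≤ (a ^ 2 + b ^ 2 - e ^ 2) / (a * b * e) + (c ^ 2 + d ^ 2 - e ^ 2) / (c * d * e)) :
    e ^ 2 ≤ (a - b) ^ 2 ∧ min a b + e ≤ max a b := by
  have h1 : (c ^ 2 + d ^ 2 - e ^ 2) / (c * d * e) ≤ -2 / e := by
    rw [div_le_div_iff₀ (by positivity) he]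
    have h : c ^ 2 + d ^ 2 - e ^ 2 ≤ -2 * (c * d) := by nlinarith
    nlinarith [mul_le_mul_of_nonneg_right h he.le]
  have h2 : 2 / e ≤ (a ^ 2 + b ^ 2 - e ^ 2) / (a * b * e) := by
    rw [neg_div] at h1
    linarith
  have h3 : e ^ 2 ≤ (a - b) ^ 2 := by
    rw [div_le_div_iff₀ he (by positivity)] at h2
    have h : 2 * (a * b) ≤ a ^ 2 + b ^ 2 - e ^ 2 := by
      refine le_of_mul_le_mul_right ?_ he
      linarith
    nlinarith
  refine ⟨h3, ?_⟩
  have h4 : e ≤ |a - b| := by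
    have h := sq_le_sq.mp h3
    rwa [abs_of_pos he] at h
  have h5 := max_sub_min_eq_abs' a b
  linarith
end

section
/- Let a graph presented in the half-edge formalism be trivalent, and let λ : E → ℝ assign a strictly positive value to every edge. Suppose that the simplicial coordinate X(e) is nonnegative for every edge e and that there is no efficient closed edge-path all of whose traversed edges have vanishing simplicial coordinate (the no vanishing cycle condition). Then at every vertex the three values of λ on the incident half-edges satisfy the three strict triangle inequalities: each is strictly less than the sum of the other two. -/
/-- A closed edge-path of length `n ≥ 1` in a graph in the half-edge formalism
(half-edges `H`, edge-pairing involution `ι`, vertex map `v`), which is moreover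
efficient (non-backtracking). -/
def IsEffClosedPath {H V : Type*} (ι : H → H) (v : H → V) (n : ℕ) (c : ZMod n → H) : Prop :=
  1 ≤ n ∧ (∀ i, v (ι (c i)) = v (c (i + 1))) ∧ ∀ i, c (i + 1) ≠ ι (c i)

/-- Lemma 3.5: in a trivalent fatgraph with positive lambda lengths `lam` on its edges, if
all simplicial coordinates `X` are nonnegative and there is no efficient closed edge-path
all of whose traversed edges have vanishing simplicial coordinate (the no vanishing cycle
condition), then the lambda lengths of the three half-edges at each vertex satisfy the
three strict triangle inequalities. -/
theorem no_vanishing_cycle_implies_triangle_inequalities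
    {H V : Type*} [Fintype H] [DecidableEq H] [Fintype V] [DecidableEq V]
    (ι : H → H) (hinv : Function.Involutive ι) (hff : ∀ h, ι h ≠ h)
    (v : H → V) (htriv : ∀ w : V, Set.ncard {h | v h = w} = 3)
    (lam : H → ℝ) (hpos : ∀ h, 0 < lam h) (hlaminv : ∀ h, lam (ι h) = lam h)
    (X : H → ℝ)
    (hX : ∀ h a b c d : H, v a = v h → v b = v h → a ≠ b → a ≠ h → b ≠ h →
      v c = v (ι h) → v d = v (ι h) → c ≠ d → c ≠ ι h → d ≠ ι h →
      X h = (lam a ^ 2 + lam b ^ 2 - lam h ^ 2) / (lam a * lam b * lam h)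
          + (lam c ^ 2 + lam d ^ 2 - lam h ^ 2) / (lam c * lam d * lam h))
    (hXnonneg : ∀ h, 0 ≤ X h)
    (hnvc : ¬ ∃ (n : ℕ) (c : ZMod n → H), IsEffClosedPath ι v n c ∧ ∀ i, X (c i) = 0) :
    ∀ h₀ h₁ h₂ : H, v h₁ = v h₀ → v h₂ = v h₀ → h₀ ≠ h₁ → h₀ ≠ h₂ → h₁ ≠ h₂ →
      lam h₀ < lam h₁ + lam h₂ := by
  classical
  intro h₀ h₁ h₂ e1 e2 n1 n2 n3
  by_contra hcon
  -- the half-edges at which the triangle inequality fails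
  let bad : H → Prop := fun h => ∃ a b, v a = v h ∧ v b = v h ∧ a ≠ b ∧ a ≠ h ∧ b ≠ h ∧
    lam a + lam b ≤ lam h
  have hne : (Finset.univ.filter bad).Nonempty :=
    ⟨h₀, by
      simp only [Finset.mem_filter, Finset.mem_univ, true_and]
      exact ⟨h₁, h₂, e1, e2, n3, n1.symm, n2.symm, not_lt.mp hcon⟩⟩
  obtain ⟨h, hh, hmax⟩ := Finset.exists_max_image _ lam hne
  simp only [Finset.mem_filter, Finset.mem_univ, true_and] at hh hmax
  obtain ⟨a, b, va, vb, hab, hah, hbh, hle⟩ := hh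
  -- the other two half-edges at the far endpoint
  obtain ⟨c, d, vc, vd, hcd, hc, hd⟩ : ∃ c d, v c = v (ι h) ∧ v d = v (ι h) ∧ c ≠ d ∧
      c ≠ ι h ∧ d ≠ ι h := by
    obtain ⟨x, y, z, hxy, hxz, hyz, hs⟩ := Set.ncard_eq_three.mp (htriv (v (ι h)))
    have key : ∀ w, v w = v (ι h) ↔ w = x ∨ w = y ∨ w = z := by
      intro w
      have := Set.ext_iff.mp hs w
      simpa using this
    have kx := (key x).mpr (by simp)
    have ky := (key y).mpr (by simp)
    have kz := (key z).mpr (by simp)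
    rcases (key (ι h)).mp rfl with hx | hx | hx
    · exact ⟨y, z, ky, kz, hyz, by rw [hx]; exact hxy.symm, by rw [hx]; exact hxz.symm⟩
    · exact ⟨x, z, kx, kz, hxz, by rw [hx]; exact hxy, by rw [hx]; exact hyz.symm⟩
    · exact ⟨x, y, kx, ky, hxy, by rw [hx]; exact hxz, by rw [hx]; exact hyz⟩
  have hx := hX h a b c d va vb hab hah hbh vc vd hcd hc hd
  have h0 := hXnonneg h
  have pa := hpos a
  have pb := hpos b
  have pc := hpos c
  have pd := hpos d
  have ph := hpos h
  have t1 : (lam a ^ 2 + lam b ^ 2 - lam h ^ 2) / (lam a * lam b * lam h) ≤ -2 / lam h := by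
    rw [div_le_div_iff₀ (by positivity) ph]
    have : lam a ^ 2 + lam b ^ 2 - lam h ^ 2 ≤ -2 * (lam a * lam b) := by nlinarith
    nlinarith [mul_le_mul_of_nonneg_right this ph.le]
  have t2 : 2 / lam h ≤ (lam c ^ 2 + lam d ^ 2 - lam h ^ 2) / (lam c * lam d * lam h) := by
    have : -2 / lam h = - (2 / lam h) := by ring
    linarith
  have t3 : 2 * (lam c * lam d) ≤ lam c ^ 2 + lam d ^ 2 - lam h ^ 2 := by
    rw [div_le_div_iff₀ ph (by positivity)] at t2
    exact le_of_mul_le_mul_right (by linarith) ph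
  have t4 : lam h ≤ |lam c - lam d| := by
    have := sq_le_sq.mp (show lam h ^ 2 ≤ (lam c - lam d) ^ 2 by nlinarith)
    rwa [abs_of_pos ph] at this
  have li := hlaminv h
  rcases le_abs.mp t4 with h5 | h5
  · have := hmax c ⟨d, ι h, by rw [vd, vc], vc.symm, hd, hcd.symm, hc.symm, by linarith⟩
    linarith
  · have := hmax d ⟨c, ι h, by rw [vd, vc], vd.symm, hc, hcd, hd.symm, by linarith⟩
    linarith
end

section
/- Let n ≥ 1 and let x₀, …, x_n and y₁, …, y_{n+1} be real-valued functions of t ∈ ℝ with strictly positive values, such that as t → ∞ one has y_{n+1}(t)/y₁(t) → 1 and x₀(t)·x_k(t)/(y_k(t)·y_{k+1}(t)) → 0 for each 1 ≤ k ≤ n. Define ζ₁(t) = √(y₂(t)·y_{n+1}(t)/(x₁(t)·x₀(t))), ζ_k(t) = √(y_{k+1}(t)·x_{k−1}(t)/(x_k(t)·y_{k−1}(t))) for 2 ≤ k ≤ n, and ζ_{n+1}(t) = √(x₀(t)·x_n(t)/(y₁(t)·y_n(t))). Then |tr( L·X(ζ₁(t))·(R·X(ζ₂(t)))⋯(R·X(ζ_{n+1}(t)))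 )| tends to 2 as t → ∞. -/
open Filter

/-- The right-turn matrix `R`. -/
def matR : Matrix (Fin 2) (Fin 2) ℝ := !![1, 1; -1, 0]

/-- The left-turn matrix `L`. -/
def matL : Matrix (Fin 2) (Fin 2) ℝ := !![0, -1; 1, 1]

/-- The edge matrix `X(ζ)`. -/
noncomputable def matX (ζ : ℝ) : Matrix (Fin 2) (Fin 2) ℝ := !![0, ζ; -ζ⁻¹, 0]

theorem prod_RX (z : ℕ → ℝ) (hz : ∀ k, z k ≠ 0) (n : ℕ) :
    (List.ofFn fun k : Fin n => matR * matX (z k.val)).prod =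
      (-1 : ℝ) ^ n • !![(∏ k ∈ Finset.range n, z k)⁻¹,
        -((∏ k ∈ Finset.range n, z k) *
          ∑ m ∈ Finset.range n, ((∏ k ∈ Finset.range m, z k) ^ 2)⁻¹);
        0, ∏ k ∈ Finset.range n, z k] := by
  induction n with
  | zero => simp [Matrix.one_fin_two]
  | succ n ih =>
    rw [List.ofFn_succ_last, List.prod_append]
    simp only [Fin.val_castSucc, Fin.val_last, List.prod_singleton]
    rw [ih, Finset.prod_range_succ, Finset.sum_range_succ]
    have hP : ∏ k ∈ Finset.range n, z k ≠ 0 := Finset.prod_ne_zero_iff.mpr fun k _ => hz k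
    generalize (∏ k ∈ Finset.range n, z k) = P at *
    generalize (∑ m ∈ Finset.range n, ((∏ k ∈ Finset.range m, z k) ^ 2)⁻¹) = S at *
    have h := hz n
    ext i j
    fin_cases i <;> fin_cases j <;>
      simp [matR, matX, Matrix.mul_apply, Fin.sum_univ_two, pow_succ] <;> field_simp <;> ring

theorem trace_formula (n : ℕ) (hn : 1 ≤ n) (x y z : ℕ → ℝ)
    (hx : ∀ i ≤ n, 0 < x i) (hy : ∀ i, 1 ≤ i → i ≤ n + 1 → 0 < y i)
    (h1 : z 1 = Real.sqrt (y 2 * y (n + 1) / (x 1 * x 0)))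
    (hmid : ∀ k, 2 ≤ k → k ≤ n →
      z k = Real.sqrt (y (k + 1) * x (k - 1) / (x k * y (k - 1))))
    (hlast : z (n + 1) = Real.sqrt (x 0 * x n / (y 1 * y n))) :
    |Matrix.trace (matL * matX (z 1) *
      (List.ofFn fun k : Fin n => matR * matX (z (k.val + 2))).prod)| =
    (y (n + 1) / y 1)⁻¹ + y (n + 1) / y 1 +
      ∑ k ∈ Finset.range n, x 0 * x (k + 1) / (y (k + 1) * y (k + 1 + 1)) := by
  have hx0 := hx 0 (by omega)
  have hx1 := hx 1 hn
  have hxn := hx n le_rfl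
  have hy1 := hy 1 (by omega) (by omega)
  have hy2 := hy 2 (by omega) (by omega)
  have hyn := hy n (by omega) (by omega)
  have hyn1 := hy (n + 1) (by omega) (by omega)
  have hz1 : 0 < z 1 := by rw [h1]; positivity
  have hz1sq : z 1 ^ 2 = y 2 * y (n + 1) / (x 1 * x 0) := by
    rw [h1, Real.sq_sqrt (by positivity)]
  have hzl : 0 < z (n + 1) := by rw [hlast]; positivity
  have hzlsq : z (n + 1) ^ 2 = x 0 * x n / (y 1 * y n) := by
    rw [hlast, Real.sq_sqrt (by positivity)]
  have hzm : ∀ k, k + 2 ≤ n → 0 < z (k + 2) ∧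
      z (k + 2) ^ 2 = y (k + 3) * x (k + 1) / (x (k + 2) * y (k + 1)) := by
    intro k hk
    have a := hx (k + 1) (by omega)
    have b := hx (k + 2) (by omega)
    have c := hy (k + 1) (by omega) (by omega)
    have d := hy (k + 3) (by omega) (by omega)
    have e := hmid (k + 2) (by omega) hk
    simp only [show k + 2 - 1 = k + 1 by omega, show k + 2 + 1 = k + 3 by omega] at e
    rw [e]
    exact ⟨by positivity, Real.sq_sqrt (by positivity)⟩
  -- modify z beyond the range so that it never vanishes
  let w : ℕ → ℝ := fun k => if k < n then z (k + 2) else 1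
  have hwpos : ∀ k, 0 < w k := by
    intro k
    simp only [w]
    split_ifs with h
    · rcases Nat.lt_or_ge (k + 1) n with h' | h'
      · exact (hzm k (by omega)).1
      · rw [show k + 2 = n + 1 by omega]; exact hzl
    · exact one_pos
  have hlist : (List.ofFn fun k : Fin n => matR * matX (z (k.val + 2))) =
      (List.ofFn fun k : Fin n => matR * matX (w k.val)) := by
    congr 1
    funext k
    simp [w]
  rw [hlist, prod_RX w (fun k => (hwpos k).ne')]
  have hP : ∀ m, m + 1 ≤ n → (∏ k ∈ Finset.range m, w k) ^ 2 =
      y (m + 1) * y (m + 2) * x 1 / (x (m + 1) * y 1 * y 2) := by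
    intro m
    induction m with
    | zero => intro _; simp; field_simp
    | succ m ih =>
      intro hm
      have a := hx (m + 1) (by omega)
      have b := hx (m + 2) (by omega)
      have c := hy (m + 1) (by omega) (by omega)
      have d := hy (m + 3) (by omega) (by omega)
      have e := hy (m + 2) (by omega) (by omega)
      rw [Finset.prod_range_succ, mul_pow, ih (by omega)]
      have : w m = z (m + 2) := by simp only [w]; rw [if_pos (by omega)]
      rw [this, (hzm m (by omega)).2]
      simp only [show m + 1 + 1 = m + 2 by omega, show m + 1 + 2 = m + 3 by omega]
      field_simp
  have hPpos : 0 < ∏ k ∈ Finset.range n, w k := Finset.prod_pos fun k _ => hwpos k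
  have hfull : z 1 * ∏ k ∈ Finset.range n, w k = y (n + 1) / y 1 := by
    have : (z 1 * ∏ k ∈ Finset.range n, w k) ^ 2 = (y (n + 1) / y 1) ^ 2 := by
      obtain ⟨m, rfl⟩ : ∃ m, n = m + 1 := ⟨n - 1, by omega⟩
      rw [Finset.prod_range_succ, mul_pow, mul_pow, hP m le_rfl, hz1sq]
      have : w m = z (m + 1 + 1) := by simp [w]
      rw [this, hzlsq]
      simp only [show m + 1 + 1 = m + 2 by omega] at *
      field_simp
    exact (pow_left_inj₀ (by positivity) (by positivity) two_ne_zero).mp this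
  have hsum : ∑ m ∈ Finset.range n, ((∏ k ∈ Finset.range m, w k) ^ 2)⁻¹ =
      (y 1 * y 2 / (x 0 * x 1)) *
      ∑ k ∈ Finset.range n, x 0 * x (k + 1) / (y (k + 1) * y (k + 1 + 1)) := by
    rw [Finset.mul_sum]
    refine Finset.sum_congr rfl fun m hm => ?_
    have hm := Finset.mem_range.mp hm
    have a := hx (m + 1) (by omega)
    have c := hy (m + 1) (by omega) (by omega)
    have e := hy (m + 2) (by omega) (by omega)
    rw [hP m (by omega)]
    simp only [show m + 1 + 1 = m + 2 by omega]
    field_simp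
  have hSnn : 0 ≤ ∑ k ∈ Finset.range n, x 0 * x (k + 1) / (y (k + 1) * y (k + 1 + 1)) := by
    refine Finset.sum_nonneg fun m hm => ?_
    have hm := Finset.mem_range.mp hm
    have a := hx (m + 1) (by omega)
    have c := hy (m + 1) (by omega) (by omega)
    have e := hy (m + 1 + 1) (by omega) (by omega)
    positivity
  rw [hsum]
  generalize (∑ k ∈ Finset.range n, x 0 * x (k + 1) / (y (k + 1) * y (k + 1 + 1))) = S at *
  generalize (∏ k ∈ Finset.range n, w k) = P at *
  rw [Matrix.mul_smul, Matrix.trace_smul, smul_eq_mul, abs_mul, abs_pow, abs_neg, abs_one,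
    one_pow, one_mul]
  have key : Matrix.trace (matL * matX (z 1) *
      !![P⁻¹, -(P * (y 1 * y 2 / (x 0 * x 1) * S)); 0, P]) =
      (z 1 * P)⁻¹ + z 1 * P + (z 1 * P) / z 1 ^ 2 * (y 1 * y 2 / (x 0 * x 1) * S) := by
    simp [matL, matX, Matrix.trace_fin_two, Matrix.mul_apply, Fin.sum_univ_two]
    field_simp
    ring
  rw [key, hfull, hz1sq]
  have : y (n + 1) / y 1 / (y 2 * y (n + 1) / (x 1 * x 0)) *
      (y 1 * y 2 / (x 0 * x 1) * S) = S := by field_simp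
  rw [this]
  exact abs_of_nonneg (by positivity)

/-- If, as `t → ∞`, `y_{n+1}(t)/y₁(t) → 1` and `x₀(t)·x_k(t)/(y_k(t)·y_{k+1}(t)) → 0` for
`1 ≤ k ≤ n`, then the absolute trace of the holonomy
`L·X(ζ₁(t))·(R·X(ζ₂(t)))⋯(R·X(ζ_{n+1}(t)))` tends to `2`: the corresponding closed curve
is asymptotically short. -/
theorem abs_trace_holonomy_tendsto_two (n : ℕ) (hn : 1 ≤ n)
    (x y : ℕ → ℝ → ℝ)
    (hx : ∀ i ≤ n, ∀ t : ℝ, 0 < x i t)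
    (hy : ∀ i, 1 ≤ i → i ≤ n + 1 → ∀ t : ℝ, 0 < y i t)
    (hyratio : Tendsto (fun t => y (n + 1) t / y 1 t) atTop (nhds 1))
    (hxy : ∀ k, 1 ≤ k → k ≤ n →
      Tendsto (fun t => x 0 t * x k t / (y k t * y (k + 1) t)) atTop (nhds 0))
    (ζ : ℕ → ℝ → ℝ)
    (hζ1 : ∀ t, ζ 1 t = Real.sqrt (y 2 t * y (n + 1) t / (x 1 t * x 0 t)))
    (hζmid : ∀ k, 2 ≤ k → k ≤ n → ∀ t,
      ζ k t = Real.sqrt (y (k + 1) t * x (k - 1) t / (x k t * y (k - 1) t)))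
    (hζlast : ∀ t, ζ (n + 1) t = Real.sqrt (x 0 t * x n t / (y 1 t * y n t))) :
    Tendsto
      (fun t =>
        |Matrix.trace
          (matL * matX (ζ 1 t) *
            (List.ofFn fun k : Fin n => matR * matX (ζ (k.val + 2) t)).prod)|)
      atTop (nhds 2) := by
  have hS : Tendsto (fun t => ∑ k ∈ Finset.range n,
      x 0 t * x (k + 1) t / (y (k + 1) t * y (k + 1 + 1) t)) atTop (nhds 0) := by
    have := tendsto_finsetSum (Finset.range n) (fun k hk =>
      hxy (k + 1) (by omega) (Finset.mem_range.mp hk))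
    simpa using this
  have hT := ((hyratio.inv₀ one_ne_zero).add hyratio).add hS
  have e : ((1 : ℝ)⁻¹ + 1 + 0) = 2 := by norm_num
  rw [e] at hT
  refine hT.congr fun t => ?_
  exact (trace_formula n hn (fun i => x i t) (fun i => y i t) (fun i => ζ i t)
    (fun i hi => hx i hi t) (fun i a b => hy i a b t) (hζ1 t)
    (fun k a b => hζmid k a b t) (hζlast t)).symm
end

section
/- Let a trivalent graph presented in the half-edge formalism be given with edge set E, and let 𝒜 be a screen on it. For any real t > 1, define λ_t : E → ℝ_{>0} by λ_t(e) = t^{d_e}, where d_e is the depth of the edge e in 𝒜. Then every simplicial coordinate of λ_t is strictly positive: X(e) > 0 for every edge e ∈ E. -/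
/-- The closed edge-path `c` traverses the edge `{a, ι a}`. -/
def TraversesEdge {H V : Type*} (ι : H → H) (_v : H → V) {n : ℕ} (c : ZMod n → H) (a : H) :
    Prop :=
  ∃ i, c i = a ∨ c i = ι a

/-- A set of edges (encoded as an `ι`-invariant set of half-edges) is recurrent if each of
its edges is traversed by some efficient closed edge-path all of whose edges lie in the set. -/
def Recurrent {H V : Type*} (ι : H → H) (v : H → V) (A : Set H) : Prop :=
  ∀ a ∈ A, ∃ (n : ℕ) (c : ZMod n → H), IsEffClosedPath ι v n c ∧
    (∀ i, c i ∈ A) ∧ TraversesEdge ι v c a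

/-- A screen on a graph: a collection `𝒜` of sets of edges (each encoded as an
`ι`-invariant set of half-edges) such that (i) the full edge set lies in `𝒜`; (ii) each
member is recurrent; (iii) any two members which meet are nested; (iv) the union of the
proper-subset members of any member `A` is a proper subset of `A`. -/
def IsScreen {H V : Type*} (ι : H → H) (v : H → V) (𝒜 : Set (Set H)) : Prop :=
  (Set.univ ∈ 𝒜) ∧
  (∀ A ∈ 𝒜, (∀ h ∈ A, ι h ∈ A) ∧ Recurrent ι v A) ∧
  (∀ A ∈ 𝒜, ∀ B ∈ 𝒜, (A ∩ B).Nonempty → A ⊆ B ∨ B ⊆ A) ∧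
  (∀ A ∈ 𝒜, ⋃₀ {B | B ∈ 𝒜 ∧ B ⊂ A} ⊂ A)

/-- The depth of a member `A` of a screen `𝒜`: the largest `m` for which there is a chain
`A = A_0 ⊊ A_1 ⊊ ⋯ ⊊ A_m = E` with all `A_i ∈ 𝒜`. -/
noncomputable def memberDepth {H : Type*} (𝒜 : Set (Set H)) (A : Set H) : ℕ :=
  sSup {m | ∃ c : ℕ → Set H, c 0 = A ∧ c m = Set.univ ∧
    (∀ i ≤ m, c i ∈ 𝒜) ∧ ∀ i < m, c i ⊂ c (i + 1)}

/-- The depth of an edge `e` in a screen `𝒜`: the maximum of the depths of the members of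
`𝒜` containing `e`. -/
noncomputable def edgeDepth {H : Type*} (𝒜 : Set (Set H)) (e : H) : ℕ :=
  sSup {d | ∃ A ∈ 𝒜, e ∈ A ∧ memberDepth 𝒜 A = d}

theorem exists_other_halfEdge {H V : Type*} (ι : H → H) (hinv : Function.Involutive ι)
    (v : H → V) (A : Set H) (hA : ∀ h ∈ A, ι h ∈ A) (hr : Recurrent ι v A) (h : H) (hh : h ∈ A) :
    ∃ x ∈ A, v x = v h ∧ x ≠ h := by
  obtain ⟨n, c, ⟨-, h1, h2⟩, hc, i, hi | hi⟩ := hr h hh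
  · refine ⟨ι (c (i - 1)), hA _ (hc _), ?_, ?_⟩
    · rw [h1, sub_add_cancel, hi]
    · have := h2 (i - 1)
      rw [sub_add_cancel, hi] at this
      exact this.symm
  · refine ⟨c (i + 1), hc _, ?_, ?_⟩
    · rw [← h1, hi, hinv]
    · have := h2 i
      rwa [hi, hinv] at this

theorem edgeDepth_bdd {H : Type*} [Finite H] (𝒜 : Set (Set H)) (e : H) :
    BddAbove {d | ∃ A ∈ 𝒜, e ∈ A ∧ memberDepth 𝒜 A = d} := by
  apply Set.Finite.bddAbove
  apply (Set.finite_range (memberDepth 𝒜)).subset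
  rintro d ⟨A, -, -, rfl⟩
  exact ⟨A, rfl⟩

theorem trivalent_cases {H V : Type*} [Finite H] (v : H → V)
    (htriv : ∀ w : V, Set.ncard {h | v h = w} = 3) (h a b x : H)
    (ha : v a = v h) (hb : v b = v h) (hab : a ≠ b) (hah : a ≠ h) (hbh : b ≠ h)
    (hx : v x = v h) (hxh : x ≠ h) : x = a ∨ x = b := by
  have hsub : ({a, b, h} : Set H) ⊆ {y | v y = v h} := by
    rintro y (rfl | rfl | rfl)
    exacts [ha, hb, rfl]
  have hcard : ({a, b, h} : Set H).ncard = 3 :=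
    Set.ncard_eq_three.mpr ⟨a, b, h, hab, hah, hbh, rfl⟩
  have heq := Set.eq_of_subset_of_ncard_le hsub (by rw [htriv, hcard]) (Set.toFinite _)
  have hmem : x ∈ ({a, b, h} : Set H) := by rw [heq]; exact hx
  rcases hmem with h1 | h1 | h1
  · exact Or.inl h1
  · exact Or.inr h1
  · exact absurd h1 hxh

theorem simplicial_term_pos (x y z : ℝ) (hx : 0 < x) (hy : 0 < y) (hz : 0 < z)
    (h : z ≤ x ∨ z ≤ y) : 0 < (x ^ 2 + y ^ 2 - z ^ 2) / (x * y * z) := by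
  apply div_pos _ (by positivity)
  rcases h with h | h <;> nlinarith [pow_le_pow_left₀ hz.le h 2, pow_pos hx 2, pow_pos hy 2]

/-- Lemma 4.2 (key computation): on a trivalent fatgraph with a screen `𝒜`, the lambda
lengths `λ(e) = t^{d_e}` (where `d_e` is the depth of `e` in `𝒜` and `t > 1`) have all
simplicial coordinates strictly positive. -/
theorem screen_depth_lambda_lengths_have_positive_simplicial_coordinates
    {H V : Type*} [Fintype H] [DecidableEq H] [Fintype V] [DecidableEq V]
    (ι : H → H) (hinv : Function.Involutive ι) (hff : ∀ h, ι h ≠ h)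
    (v : H → V) (htriv : ∀ w : V, Set.ncard {h | v h = w} = 3)
    (𝒜 : Set (Set H)) (hscreen : IsScreen ι v 𝒜)
    (t : ℝ) (ht : 1 < t)
    (lam : H → ℝ) (hlam : ∀ h, lam h = t ^ edgeDepth 𝒜 h) :
    ∀ h a b c d : H, v a = v h → v b = v h → a ≠ b → a ≠ h → b ≠ h →
      v c = v (ι h) → v d = v (ι h) → c ≠ d → c ≠ ι h → d ≠ ι h →
      0 < (lam a ^ 2 + lam b ^ 2 - lam h ^ 2) / (lam a * lam b * lam h)
        + (lam c ^ 2 + lam d ^ 2 - lam h ^ 2) / (lam c * lam d * lam h) := by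
  have hpos : ∀ h, 0 < lam h := fun h => by rw [hlam]; exact pow_pos (by linarith) _
  obtain ⟨huniv, hrec, -, -⟩ := hscreen
  intro h a b c d ha hb hab hah hbh hc hd hcd hch hdh
  obtain ⟨A, hA, hhA, hdep⟩ : ∃ A ∈ 𝒜, h ∈ A ∧ memberDepth 𝒜 A = edgeDepth 𝒜 h :=
    Nat.sSup_mem (s := {d | ∃ A ∈ 𝒜, h ∈ A ∧ memberDepth 𝒜 A = d})
      ⟨_, Set.univ, huniv, trivial, rfl⟩ (edgeDepth_bdd 𝒜 h)
  obtain ⟨hinvA, hrA⟩ := hrec A hA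
  have hle : ∀ x ∈ A, lam h ≤ lam x := by
    intro x hx
    rw [hlam, hlam]
    apply pow_le_pow_right₀ ht.le
    rw [← hdep]
    exact le_csSup (edgeDepth_bdd 𝒜 x) ⟨A, hA, hx, rfl⟩
  apply add_pos
  · obtain ⟨x, hxA, hx, hxh⟩ := exists_other_halfEdge ι hinv v A hinvA hrA h hhA
    apply simplicial_term_pos _ _ _ (hpos _) (hpos _) (hpos _)
    rcases trivalent_cases v htriv h a b x ha hb hab hah hbh hx hxh with rfl | rfl
    exacts [Or.inl (hle _ hxA), Or.inr (hle _ hxA)]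
  · obtain ⟨x, hxA, hx, hxh⟩ := exists_other_halfEdge ι hinv v A hinvA hrA (ι h) (hinvA h hhA)
    apply simplicial_term_pos _ _ _ (hpos _) (hpos _) (hpos _)
    rcases trivalent_cases v htriv (ι h) c d x hc hd hcd hch hdh hx hxh with rfl | rfl
    exacts [Or.inl (hle _ hxA), Or.inr (hle _ hxA)]
end

section
/- Let 𝒜 be a screen on a graph presented in the half-edge formalism, and let A ∈ 𝒜 be such that the subgraph G_A is a simple cycle, i.e., G_A is connected and every vertex of G_A has valence exactly two in G_A. Then for every B ∈ 𝒜 with A ∩ B ≠ ∅ one has A ⊆ B; that is, simple cycles are necessarily atomic in any screen. -/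
/-- If `A` is a member of a screen `𝒜` whose subgraph `G_A` is a simple cycle (connected,
with every vertex of `G_A` of valence exactly two in `G_A`), then every member of `𝒜`
meeting `A` contains `A`: simple cycles are atomic in any screen. -/
theorem simple_cycles_are_atomic
    {H V : Type*} [Fintype H] [DecidableEq H] [Fintype V] [DecidableEq V]
    (ι : H → H) (hinv : Function.Involutive ι) (hff : ∀ h, ι h ≠ h)
    (v : H → V) (𝒜 : Set (Set H)) (hscreen : IsScreen ι v 𝒜)
    (A : Set H) (hA : A ∈ 𝒜)
    (hconn : ∀ w w' : V, (∃ h ∈ A, v h = w) → (∃ h ∈ A, v h = w') →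
      Relation.ReflTransGen (fun a b => ∃ h ∈ A, v h = a ∧ v (ι h) = b) w w')
    (hval : ∀ w : V, (∃ h ∈ A, v h = w) → Set.ncard {h | h ∈ A ∧ v h = w} = 2) :
    ∀ B ∈ 𝒜, (A ∩ B).Nonempty → A ⊆ B := by
  intro B hB ⟨x, hxA, hxB⟩
  obtain ⟨-, hrec, hnest, -⟩ := hscreen
  rcases hnest A hA B hB ⟨x, hxA, hxB⟩ with h | hBA
  · exact h
  obtain ⟨hBι, hBrec⟩ := hrec B hB
  -- every vertex touched by `B` has two distinct half-edges in `B`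
  have key : ∀ b ∈ B, ∀ h ∈ A, v h = v b → h ∈ B := by
    intro b hb h hh hvh
    have hex : ∃ d ∈ B, v d = v b ∧ b ≠ d := by
      obtain ⟨n, c, ⟨-, hc1, hc2⟩, hcB, i, hi | hi⟩ := hBrec b hb
      · have h1 := hc1 (i - 1)
        have h2 := hc2 (i - 1)
        rw [sub_add_cancel, hi] at h1 h2
        exact ⟨ι (c (i - 1)), hBι _ (hcB _), h1, h2⟩
      · have h1 := hc1 i
        have h2 := hc2 i
        rw [hi, hinv b] at h1 h2
        exact ⟨c (i + 1), hcB _, h1.symm, h2.symm⟩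
    obtain ⟨d, hd, hvd, hne⟩ := hex
    have hcard := hval (v b) ⟨b, hBA hb, rfl⟩
    have hsub : ({b, d} : Set H) ⊆ {h | h ∈ A ∧ v h = v b} := by
      rintro y (rfl | rfl)
      · exact ⟨hBA hb, rfl⟩
      · exact ⟨hBA hd, hvd⟩
    have heq := Set.eq_of_subset_of_ncard_le hsub
      (by rw [hcard, Set.ncard_pair hne]) (Set.toFinite _)
    have hmem : h ∈ ({b, d} : Set H) := by
      rw [heq]
      exact ⟨hh, hvh⟩
    rcases hmem with rfl | rfl
    · exact hb
    · exact hd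
  intro a ha
  have hall : ∀ h ∈ A, v h = v a → h ∈ B := by
    have hpath := hconn (v x) (v a) ⟨x, hxA, rfl⟩ ⟨a, ha, rfl⟩
    generalize v a = w at hpath ⊢
    induction hpath with
    | refl => exact key x hxB
    | tail _ hstep ih =>
      obtain ⟨h, hh, h1, h2⟩ := hstep
      intro k hk hvk
      exact key (ι h) (hBι _ (ih h hh h1)) k hk (hvk.trans h2.symm)
  exact hall a ha rfl
end
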